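/- arXiv:1301.7349 — 2 statements merged into one kernel-verified Lean document; each statement's English description precedes it below -/
import Mathlib

section
/- Let f : [0,∞) → ℝ be operator convex and n ≥ 1. Then the non-commutative f-divergence functional Θ is jointly operator convex: for n-tuples L̃ = (L_1,…,L_n), L̃' = (L'_1,…,L'_n) of positive operators on H, n-tuples R̃ = (R_1,…,R_n), R̃' = (R'_1,…,R'_n) of strictly positive operators on H, and every λ ∈ [0,1], one has Θ(λL̃+(1−λ)L̃', λR̃+(1−λ)R̃') ≤ λΘ(L̃,R̃) + (1−λ)Θ(L̃',R̃') in the Loewner order. -/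
open scoped InnerProductSpace

noncomputable section

/-- A continuous function `f : [0, ∞) → ℝ` is *operator convex* if for every complex Hilbert
space `K`, all selfadjoint operators `A, B` on `K` with spectra in `[0, ∞)` and every
`λ ∈ [0, 1]` one has `f(λA + (1-λ)B) ≤ λ f(A) + (1-λ) f(B)` in the Loewner order, where
`f(A)` is given by the continuous functional calculus. -/
def OperatorConvexOn (f : ℝ → ℝ) : Prop :=
  ∀ (K : Type) [NormedAddCommGroup K] [InnerProductSpace ℂ K] [CompleteSpace K],
    ∀ A B : K →L[ℂ] K, IsSelfAdjoint A → IsSelfAdjoint B →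
      spectrum ℝ A ⊆ Set.Ici (0 : ℝ) → spectrum ℝ B ⊆ Set.Ici (0 : ℝ) →
      ∀ lam : ℝ, lam ∈ Set.Icc (0 : ℝ) 1 →
        cfc f (lam • A + (1 - lam) • B) ≤ lam • cfc f A + (1 - lam) • cfc f B

variable {H : Type} [NormedAddCommGroup H] [InnerProductSpace ℂ H] [CompleteSpace H]

/-- `R^{1/2}` via the continuous functional calculus. -/
def opSqrt (R : H →L[ℂ] H) : H →L[ℂ] H := cfc Real.sqrt R

/-- `R^{-1/2}` via the continuous functional calculus. -/
def opInvSqrt (R : H →L[ℂ] H) : H →L[ℂ] H := cfc (fun t : ℝ => (Real.sqrt t)⁻¹) R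

/-- The non-commutative perspective `g(L, R) = R^{1/2} f(R^{-1/2} L R^{-1/2}) R^{1/2}`. -/
def persp (f : ℝ → ℝ) (L R : H →L[ℂ] H) : H →L[ℂ] H :=
  opSqrt R * cfc f (opInvSqrt R * L * opInvSqrt R) * opSqrt R

open ContinuousLinearMap in
/-- The continuous functional calculus respects intertwining relations. -/
theorem cfc_comp_of_intertwine {E F : Type*} [NormedAddCommGroup E] [InnerProductSpace ℂ E]
    [CompleteSpace E] [NormedAddCommGroup F] [InnerProductSpace ℂ F] [CompleteSpace F]
    {f : ℝ → ℝ} (hf : ContinuousOn f (Set.Ici (0 : ℝ))) {T : E →L[ℂ] E} {Z : F →L[ℂ] F}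
    (hT : 0 ≤ T) (hZ : 0 ≤ Z) (V : E →L[ℂ] F) (h : Z ∘L V = V ∘L T) :
    cfc f Z ∘L V = V ∘L cfc f T := by
  have hTs : IsSelfAdjoint T := hT.isSelfAdjoint
  have hZs : IsSelfAdjoint Z := hZ.isSelfAdjoint
  obtain ⟨M, hM⟩ : ∃ M : ℝ, ∀ x, x ∈ spectrum ℝ T ∨ x ∈ spectrum ℝ Z → x ≤ M := by
    obtain ⟨M₁, h₁⟩ := (spectrum.isCompact (𝕜 := ℝ) T).bddAbove
    obtain ⟨M₂, h₂⟩ := (spectrum.isCompact (𝕜 := ℝ) Z).bddAbove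
    exact ⟨max M₁ M₂, fun x hx => hx.elim (fun hx => (h₁ hx).trans (le_max_left _ _))
      fun hx => (h₂ hx).trans (le_max_right _ _)⟩
  have hsT : spectrum ℝ T ⊆ Set.Icc 0 M := fun x hx =>
    ⟨spectrum_nonneg_of_nonneg hT hx, hM x (.inl hx)⟩
  have hsZ : spectrum ℝ Z ⊆ Set.Icc 0 M := fun x hx =>
    ⟨spectrum_nonneg_of_nonneg hZ hx, hM x (.inr hx)⟩
  have hfM : ContinuousOn f (Set.Icc 0 M) := hf.mono Set.Icc_subset_Ici_self
  have hpoly (p : Polynomial ℝ) : Polynomial.aeval Z p ∘L V = V ∘L Polynomial.aeval T p := by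
    induction p using Polynomial.induction_on' with
    | add p q hp hq => simp only [map_add, add_comp, comp_add, hp, hq]
    | monomial n a =>
      have hpow : (Z ^ n) ∘L V = V ∘L (T ^ n) := by
        induction n with
        | zero => rfl
        | succ n ih =>
          rw [pow_succ, pow_succ', mul_def, mul_def, comp_assoc, h, ← comp_assoc, ih, comp_assoc,
            ← mul_def, ← mul_def, ← pow_succ, ← pow_succ']
      simp only [Polynomial.aeval_monomial, ← Algebra.smul_def, smul_comp, hpow]
      ext x
      simp
  refine eq_of_norm_sub_le_zero (le_of_forall_pos_le_add fun δ hδ => ?_)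
  set ε := δ / (2 * (‖V‖ + 1)) with hεdef
  have hV : 0 ≤ ‖V‖ := norm_nonneg V
  have hε : 0 < ε := by positivity
  obtain ⟨p, hp⟩ := exists_polynomial_near_of_continuousOn 0 M f hfM ε hε
  have hdec : cfc f Z ∘L V - V ∘L cfc f T =
      V ∘L (Polynomial.aeval T p - cfc f T) - (Polynomial.aeval Z p - cfc f Z) ∘L V := by
    rw [comp_sub, sub_comp, hpoly]; abel
  have h₁ : ‖Polynomial.aeval T p - cfc f T‖ ≤ ε := by
    rw [← cfc_polynomial p T hTs, ← cfc_sub _ _ _ p.continuousOn (hfM.mono hsT)]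
    exact norm_cfc_le hε.le fun x hx => (hp x (hsT hx)).le
  have h₂ : ‖Polynomial.aeval Z p - cfc f Z‖ ≤ ε := by
    rw [← cfc_polynomial p Z hZs, ← cfc_sub _ _ _ p.continuousOn (hfM.mono hsZ)]
    exact norm_cfc_le hε.le fun x hx => (hp x (hsZ hx)).le
  calc ‖cfc f Z ∘L V - V ∘L cfc f T‖
      ≤ ‖V‖ * ε + ε * ‖V‖ := by
        rw [hdec]
        refine (norm_sub_le _ _).trans (add_le_add ?_ ?_)
        · exact (opNorm_comp_le _ _).trans (by gcongr)
        · exact (opNorm_comp_le _ _).trans (by gcongr)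
    _ ≤ 2 * (‖V‖ + 1) * ε := by nlinarith
    _ = 0 + δ := by rw [hεdef]; field_simp; ring

open ContinuousLinearMap in
/-- Compression of an order inequality by an operator. -/
theorem adjoint_conj_mono {E F : Type*} [NormedAddCommGroup E] [InnerProductSpace ℂ E]
    [CompleteSpace E] [NormedAddCommGroup F] [InnerProductSpace ℂ F] [CompleteSpace F]
    {S T : E →L[ℂ] E} (h : S ≤ T) (V : F →L[ℂ] E) :
    adjoint V ∘L S ∘L V ≤ adjoint V ∘L T ∘L V := by
  rw [le_def] at h ⊢
  simpa only [sub_comp, comp_sub] using h.adjoint_conj V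

open ContinuousLinearMap in
theorem adjoint_conj_nonneg {E F : Type*} [NormedAddCommGroup E] [InnerProductSpace ℂ E]
    [CompleteSpace E] [NormedAddCommGroup F] [InnerProductSpace ℂ F] [CompleteSpace F]
    {T : E →L[ℂ] E} (h : 0 ≤ T) (V : F →L[ℂ] E) :
    0 ≤ adjoint V ∘L T ∘L V := by
  simpa using adjoint_conj_mono h V

open ContinuousLinearMap in
/-- Jensen's operator inequality for compressions by an isometry. -/
theorem OperatorConvexOn.cfc_adjoint_conj_le {E F : Type} [NormedAddCommGroup E]
    [InnerProductSpace ℂ E] [CompleteSpace E] [NormedAddCommGroup F] [InnerProductSpace ℂ F]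
    [CompleteSpace F] {f : ℝ → ℝ} (hf : OperatorConvexOn f)
    (hfc : ContinuousOn f (Set.Ici (0 : ℝ))) {D : F →L[ℂ] F} (hD : 0 ≤ D) (V : E →L[ℂ] F)
    (hV : adjoint V ∘L V = 1) :
    cfc f (adjoint V ∘L D ∘L V) ≤ adjoint V ∘L cfc f D ∘L V := by
  have hVx (x : E) : adjoint V (V x) = x := congr($hV x)
  set U : F →L[ℂ] F := (2 : ℂ) • (V ∘L adjoint V) - 1 with hU
  have hUadj : adjoint U = U := by
    simp [hU, ← star_eq_adjoint, star_smul]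
    simp [star_eq_adjoint, adjoint_comp]
  have hUU (y : F) : U (U y) = y := by
    simp only [hU, sub_apply, smul_apply, comp_apply, one_apply_eq_self, map_sub, map_smul, hVx]
    module
  have hUV (x : E) : U (V x) = V x := by
    simp only [hU, sub_apply, smul_apply, comp_apply, one_apply_eq_self, hVx]
    module
  have hD' : 0 ≤ U ∘L D ∘L U := by simpa only [hUadj] using adjoint_conj_nonneg hD U
  have hT := adjoint_conj_nonneg hD V
  set Z : F →L[ℂ] F := (1 / 2 : ℝ) • D + (1 - 1 / 2 : ℝ) • (U ∘L D ∘L U) with hZdef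
  have hZ : 0 ≤ Z := add_nonneg (smul_nonneg (by norm_num) hD) (smul_nonneg (by norm_num) hD')
  have hZV : Z ∘L V = V ∘L (adjoint V ∘L D ∘L V) := by
    ext x
    simp only [hZdef, add_apply, smul_apply, comp_apply, hUV]
    simp only [hU, sub_apply, smul_apply, comp_apply, one_apply_eq_self]
    module
  have hfU : cfc f (U ∘L D ∘L U) ∘L U = U ∘L cfc f D :=
    cfc_comp_of_intertwine hfc hD hD' U (by ext x; simp [hUU])
  have hfZ := cfc_comp_of_intertwine hfc hT hZ V hZV
  have hconv := hf F D (U ∘L D ∘L U) hD.isSelfAdjoint hD'.isSelfAdjoint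
    (fun x hx => spectrum_nonneg_of_nonneg hD hx) (fun x hx => spectrum_nonneg_of_nonneg hD' hx)
    (1 / 2) (by norm_num)
  have hcomp := adjoint_conj_mono hconv V
  have hl : adjoint V ∘L cfc f Z ∘L V = cfc f (adjoint V ∘L D ∘L V) := by
    rw [hfZ, ← comp_assoc, hV]; rfl
  have hadjU (y : F) : adjoint V (U y) = adjoint V y := by
    simp only [hU, sub_apply, smul_apply, comp_apply, one_apply_eq_self, map_sub, map_smul, hVx]
    module
  have hr : adjoint V ∘L ((1 / 2 : ℝ) • cfc f D + (1 - 1 / 2 : ℝ) • cfc f (U ∘L D ∘L U)) ∘L V =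
      adjoint V ∘L cfc f D ∘L V := by
    ext x
    have hx : cfc f (U ∘L D ∘L U) (V x) = U (cfc f D (V x)) := by
      simpa [hUV] using congr($hfU (V x))
    simp only [comp_apply, add_apply, smul_apply, hx, map_add, map_smul_of_tower, hadjU]
    module
  rwa [hl, hr] at hcomp

open ContinuousLinearMap in
/-- Jensen's operator inequality for a pair of operators whose column is an isometry. -/
theorem OperatorConvexOn.cfc_adjoint_conj_add_le {f : ℝ → ℝ} (hf : OperatorConvexOn f)
    (hfc : ContinuousOn f (Set.Ici (0 : ℝ))) {X Y : H →L[ℂ] H} (hX : 0 ≤ X) (hY : 0 ≤ Y)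
    (A B : H →L[ℂ] H) (hAB : star A * A + star B * B = 1) :
    cfc f (star A * X * A + star B * Y * B) ≤
      star A * cfc f X * A + star B * cfc f Y * B := by
  let e := (WithLp.prodContinuousLinearEquiv 2 ℂ H H).symm
  let J₁ : H →L[ℂ] WithLp 2 (H × H) := (e : H × H →L[ℂ] WithLp 2 (H × H)) ∘L inl ℂ H H
  let J₂ : H →L[ℂ] WithLp 2 (H × H) := (e : H × H →L[ℂ] WithLp 2 (H × H)) ∘L inr ℂ H H
  have h₁₁ (x : H) : adjoint J₁ (J₁ x) = x :=
    ext_inner_left ℂ fun y => by simp [adjoint_inner_right, J₁, e, WithLp.prod_inner_apply]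
  have h₂₂ (x : H) : adjoint J₂ (J₂ x) = x :=
    ext_inner_left ℂ fun y => by simp [adjoint_inner_right, J₂, e, WithLp.prod_inner_apply]
  have h₁₂ (x : H) : adjoint J₁ (J₂ x) = 0 :=
    ext_inner_left ℂ fun y => by simp [adjoint_inner_right, J₁, J₂, e, WithLp.prod_inner_apply]
  have h₂₁ (x : H) : adjoint J₂ (J₁ x) = 0 :=
    ext_inner_left ℂ fun y => by simp [adjoint_inner_right, J₁, J₂, e, WithLp.prod_inner_apply]
  clear_value J₁ J₂
  set D := J₁ ∘L X ∘L adjoint J₁ + J₂ ∘L Y ∘L adjoint J₂ with hDdef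
  have hD : 0 ≤ D := add_nonneg
    (by simpa only [adjoint_adjoint] using adjoint_conj_nonneg hX (adjoint J₁))
    (by simpa only [adjoint_adjoint] using adjoint_conj_nonneg hY (adjoint J₂))
  have hD₁ := cfc_comp_of_intertwine hfc hX hD J₁ (by ext x; simp [hDdef, h₁₁, h₂₁])
  have hD₂ := cfc_comp_of_intertwine hfc hY hD J₂ (by ext x; simp [hDdef, h₂₂, h₁₂])
  have hD₁x (x : H) : cfc f D (J₁ x) = J₁ (cfc f X x) := congr($hD₁ x)
  have hD₂x (x : H) : cfc f D (J₂ x) = J₂ (cfc f Y x) := congr($hD₂ x)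
  set V := J₁ ∘L A + J₂ ∘L B with hVdef
  have hV : adjoint V ∘L V = 1 := by
    rw [← hAB]
    ext x
    simp [star_eq_adjoint, hVdef, h₁₁, h₁₂, h₂₁, h₂₂]
  convert hf.cfc_adjoint_conj_le hfc hD V hV using 2
  · ext x
    simp [star_eq_adjoint, hVdef, hDdef, h₁₁, h₁₂, h₂₁, h₂₂]
  · ext x
    simp [star_eq_adjoint, hVdef, hD₁x, hD₂x, h₁₁, h₁₂, h₂₁, h₂₂]

theorem isSelfAdjoint_opSqrt (R : H →L[ℂ] H) : IsSelfAdjoint (opSqrt R) :=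
  cfc_predicate _ _

theorem isSelfAdjoint_opInvSqrt (R : H →L[ℂ] H) : IsSelfAdjoint (opInvSqrt R) :=
  cfc_predicate _ _

theorem opSqrt_mul_opSqrt {R : H →L[ℂ] H} (hR : 0 ≤ R) : opSqrt R * opSqrt R = R := by
  have hs : IsSelfAdjoint R := hR.isSelfAdjoint
  rw [opSqrt, ← cfc_mul _ _ R]
  conv_rhs => rw [← cfc_id' ℝ R]
  exact cfc_congr fun x hx => Real.mul_self_sqrt (spectrum_nonneg_of_nonneg hR hx)

theorem opInvSqrt_mul_opSqrt {R : H →L[ℂ] H} (hR : IsStrictlyPositive R) :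
    opInvSqrt R * opSqrt R = 1 := by
  have hs : IsSelfAdjoint R := hR.isSelfAdjoint
  have hpos (x : ℝ) (hx : x ∈ spectrum ℝ R) : Real.sqrt x ≠ 0 :=
    (Real.sqrt_pos.2 (hR.spectrum_pos hx)).ne'
  rw [opSqrt, opInvSqrt, ← cfc_mul (fun t => (√t)⁻¹) _ R
    (Real.continuous_sqrt.continuousOn.inv₀ hpos), ← cfc_one ℝ R]
  exact cfc_congr fun x hx => inv_mul_cancel₀ (hpos x hx)

theorem opSqrt_mul_opInvSqrt {R : H →L[ℂ] H} (hR : IsStrictlyPositive R) :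
    opSqrt R * opInvSqrt R = 1 := by
  simpa [(isSelfAdjoint_opSqrt R).star_eq, (isSelfAdjoint_opInvSqrt R).star_eq] using
    congr(star $(opInvSqrt_mul_opSqrt hR))

/-- The non-commutative perspective of an operator convex function is jointly convex. -/
theorem OperatorConvexOn.persp_le {f : ℝ → ℝ} (hf : OperatorConvexOn f)
    (hfc : ContinuousOn f (Set.Ici (0 : ℝ))) {L L' R R' : H →L[ℂ] H} (hL : 0 ≤ L) (hL' : 0 ≤ L')
    (hR : IsStrictlyPositive R) (hR' : IsStrictlyPositive R') {a b : ℝ} (ha : 0 ≤ a) (hb : 0 ≤ b)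
    (hS : IsStrictlyPositive (a • R + b • R')) :
    persp f (a • L + b • L') (a • R + b • R') ≤ a • persp f L R + b • persp f L' R' := by
  set S := a • R + b • R' with hSdef
  have hsa := Real.mul_self_sqrt ha
  have hsb := Real.mul_self_sqrt hb
  set A := √a • (opSqrt R * opInvSqrt S) with hA
  set B := √b • (opSqrt R' * opInvSqrt S) with hB
  have hAstar : star A = √a • (opInvSqrt S * opSqrt R) := by
    simp [hA, (isSelfAdjoint_opSqrt R).star_eq, (isSelfAdjoint_opInvSqrt S).star_eq]
  have hBstar : star B = √b • (opInvSqrt S * opSqrt R') := by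
    simp [hB, (isSelfAdjoint_opSqrt R').star_eq, (isSelfAdjoint_opInvSqrt S).star_eq]
  have hAconj (X : H →L[ℂ] H) :
      star A * X * A = opInvSqrt S * (a • (opSqrt R * X * opSqrt R)) * opInvSqrt S := by
    rw [hAstar]
    simp only [hA, smul_mul_assoc, mul_smul_comm, smul_smul, hsa, mul_assoc]
  have hBconj (X : H →L[ℂ] H) :
      star B * X * B = opInvSqrt S * (b • (opSqrt R' * X * opSqrt R')) * opInvSqrt S := by
    rw [hBstar]
    simp only [hB, smul_mul_assoc, mul_smul_comm, smul_smul, hsb, mul_assoc]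
  have hAB : star A * A + star B * B = 1 := by
    rw [← mul_one (star A), ← mul_one (star B), hAconj, hBconj, mul_one, mul_one,
      opSqrt_mul_opSqrt hR.nonneg, opSqrt_mul_opSqrt hR'.nonneg, ← add_mul, ← mul_add, ← hSdef]
    nth_rw 2 [← opSqrt_mul_opSqrt hS.nonneg]
    rw [← mul_assoc, opInvSqrt_mul_opSqrt hS, one_mul, opSqrt_mul_opInvSqrt hS]
  have hcancel {Q : H →L[ℂ] H} (hQ : IsStrictlyPositive Q) (M : H →L[ℂ] H) :
      opSqrt Q * (opInvSqrt Q * M * opInvSqrt Q) * opSqrt Q = M := by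
    rw [show opSqrt Q * (opInvSqrt Q * M * opInvSqrt Q) * opSqrt Q =
      (opSqrt Q * opInvSqrt Q) * M * (opInvSqrt Q * opSqrt Q) by simp only [mul_assoc],
      opSqrt_mul_opInvSqrt hQ, opInvSqrt_mul_opSqrt hQ, one_mul, mul_one]
  have hnn {M : H →L[ℂ] H} (hM : 0 ≤ M) (Q : H →L[ℂ] H) : 0 ≤ opInvSqrt Q * M * opInvSqrt Q :=
    (isSelfAdjoint_opInvSqrt Q).conjugate_nonneg hM
  have key := hf.cfc_adjoint_conj_add_le hfc (hnn hL R) (hnn hL' R') A B hAB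
  simp only [hAconj, hBconj, hcancel hR, hcancel hR', ← add_mul, ← mul_add] at key
  have := (isSelfAdjoint_opSqrt S).conjugate_le_conjugate key
  rwa [hcancel hS] at this

/-- The non-commutative `f`-divergence functional
`Θ(L̃, R̃) = ∑ i, R i ^ (1/2) * f(R i ^ (-1/2) * L i * R i ^ (-1/2)) * R i ^ (1/2)`
is jointly operator convex when `f` is operator convex. -/
theorem stmt_0 (f : ℝ → ℝ) (hf_cont : ContinuousOn f (Set.Ici (0 : ℝ)))
    (hf : OperatorConvexOn f) (n : ℕ) (hn : 1 ≤ n)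
    (L L' R R' : Fin n → H →L[ℂ] H)
    (hL : ∀ i, 0 ≤ L i) (hL' : ∀ i, 0 ≤ L' i)
    (hR : ∀ i, 0 ≤ R i ∧ IsUnit (R i)) (hR' : ∀ i, 0 ≤ R' i ∧ IsUnit (R' i))
    (lam : ℝ) (hlam : lam ∈ Set.Icc (0 : ℝ) 1) :
    (∑ i, persp f (lam • L i + (1 - lam) • L' i) (lam • R i + (1 - lam) • R' i)) ≤
      lam • (∑ i, persp f (L i) (R i)) + (1 - lam) • (∑ i, persp f (L' i) (R' i)) := by
  have hSP (i : Fin n) : IsStrictlyPositive (lam • R i + (1 - lam) • R' i) := by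
    obtain ⟨h0, h1⟩ := hlam
    have hr : IsStrictlyPositive (R i) := ⟨(hR i).1, (hR i).2⟩
    have hr' : IsStrictlyPositive (R' i) := ⟨(hR' i).1, (hR' i).2⟩
    rcases h0.eq_or_lt with rfl | h0
    · simpa using hr'
    · exact (hr.smul h0).add_nonneg (smul_nonneg (sub_nonneg.2 h1) hr'.nonneg)
  rw [Finset.smul_sum, Finset.smul_sum, ← Finset.sum_add_distrib]
  exact Finset.sum_le_sum fun i _ => hf.persp_le hf_cont (hL i) (hL' i) ⟨(hR i).1, (hR i).2⟩
    ⟨(hR' i).1, (hR' i).2⟩ hlam.1 (sub_nonneg.2 hlam.2) (hSP i)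
end
end

section
/- Let f_1, f_2 : [0,∞) → ℝ be operator convex functions. The following are equivalent: (1) f_1(t) ≤ f_2(t) for all t ≥ 0; (2) f_1(Φ(A)) ≤ Φ(f_2(A)) for every complex Hilbert space H, every unital positive linear map Φ on the bounded operators on H, and every positive operator A on H. -/
open scoped InnerProductSpace

noncomputable section

variable {H : Type} [NormedAddCommGroup H] [InnerProductSpace ℂ H] [CompleteSpace H]

open ContinuousLinearMap in
/-- The continuous functional calculus respects intertwining relations. -/
lemma cfc_comp_eq_comp_cfc {K E : Type*}
    [NormedAddCommGroup K] [InnerProductSpace ℂ K] [CompleteSpace K]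
    [NormedAddCommGroup E] [InnerProductSpace ℂ E] [CompleteSpace E]
    {S : E →L[ℂ] E} {B : K →L[ℂ] K} (hS : IsSelfAdjoint S) (hB : IsSelfAdjoint B)
    {V : K →L[ℂ] E} (h : S ∘L V = V ∘L B) {f : ℝ → ℝ}
    (hf : ContinuousOn f (spectrum ℝ S ∪ spectrum ℝ B)) :
    cfc f S ∘L V = V ∘L cfc f B := by
  set s : Set ℝ := spectrum ℝ S ∪ spectrum ℝ B
  have hs : IsCompact s := (ContinuousFunctionalCalculus.isCompact_spectrum S).union
    (ContinuousFunctionalCalculus.isCompact_spectrum B)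
  have : CompactSpace s := isCompact_iff_compactSpace.mp hs
  have hSs : spectrum ℝ S ⊆ s := Set.subset_union_left
  have hBs : spectrum ℝ B ⊆ s := Set.subset_union_right
  have key : ∀ g : C(s, ℝ), cfcHomSuperset hS hSs g ∘L V = V ∘L cfcHomSuperset hB hBs g := by
    intro g
    induction g using ContinuousMap.induction_on_of_compact with
    | const r =>
      have hr : ContinuousMap.const s r = algebraMap ℝ C(s, ℝ) r := rfl
      rw [hr, AlgHomClass.commutes, AlgHomClass.commutes]
      ext x
      simp [Algebra.algebraMap_eq_smul_one]
    | id => rwa [cfcHomSuperset_id, cfcHomSuperset_id]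
    | star_id => rwa [star_trivial, cfcHomSuperset_id, cfcHomSuperset_id]
    | add f g hf hg => rw [map_add, map_add, add_comp, comp_add, hf, hg]
    | mul f g hf hg =>
      rw [map_mul, map_mul, mul_def, mul_def, comp_assoc, hg, ← comp_assoc, hf, comp_assoc]
    | frequently f hf =>
      have h1 := cfcHomSuperset_continuous hS hSs
      have h2 := cfcHomSuperset_continuous hB hBs
      exact hf.mem_of_closed <| isClosed_eq (h1.clm_comp_const V) (h2.const_clm_comp V)
  have h := key ⟨s.domRestrict f, hf.domRestrict⟩
  rw [cfc_apply f S hS (hf.mono hSs), cfc_apply f B hB (hf.mono hBs)]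
  exact h

open ContinuousLinearMap in
/-- Jensen's operator inequality for compression by an isometry. -/
lemma OperatorConvexOn.cfc_adjoint_comp_le {K E : Type}
    [NormedAddCommGroup K] [InnerProductSpace ℂ K] [CompleteSpace K]
    [NormedAddCommGroup E] [InnerProductSpace ℂ E] [CompleteSpace E]
    {f : ℝ → ℝ} (hf : OperatorConvexOn f) (hfc : ContinuousOn f (Set.Ici 0))
    {V : K →L[ℂ] E} (hV : adjoint V ∘L V = 1) {T : E →L[ℂ] E} (hT : 0 ≤ T) :
    cfc f (adjoint V ∘L T ∘L V) ≤ adjoint V ∘L cfc f T ∘L V := by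
  have hVx : ∀ x, adjoint V (V x) = x := fun x => DFunLike.congr_fun hV x
  set U : E →L[ℂ] E := V ∘L adjoint V + V ∘L adjoint V - 1 with hU
  have hUV : U ∘L V = V := by ext x; simp [hU, hVx]
  have hUU : U * U = 1 := by ext x; simp [hU, hVx]
  have hUs : adjoint U = U := by
    simp [hU, map_sub, map_add, adjoint_comp, ← star_eq_adjoint (1 : E →L[ℂ] E)]
  have hVU : adjoint V ∘L U = adjoint V := by
    rw [← hUs, ← adjoint_comp, hUV]
  have hT' : 0 ≤ U * T * U := by
    have := (nonneg_iff_isPositive T).1 hT |>.conj_adjoint U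
    rw [hUs] at this
    exact (nonneg_iff_isPositive _).2 this
  have hB : 0 ≤ adjoint V ∘L T ∘L V :=
    (nonneg_iff_isPositive _).2 (((nonneg_iff_isPositive T).1 hT).adjoint_conj V)
  have spec : ∀ {F : Type} [NormedAddCommGroup F] [InnerProductSpace ℂ F] [CompleteSpace F]
      {A : F →L[ℂ] F}, 0 ≤ A → spectrum ℝ A ⊆ Set.Ici 0 := fun hA x hx =>
    spectrum_nonneg_of_nonneg hA hx
  have hconv := hf E T (U * T * U) (.of_nonneg hT) (.of_nonneg hT') (spec hT) (spec hT')
    (1 / 2) (by norm_num)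
  set S : E →L[ℂ] E := (1 / 2 : ℝ) • T + (1 - 1 / 2 : ℝ) • (U * T * U) with hSdef
  have hS : 0 ≤ S := add_nonneg (smul_nonneg (by norm_num) hT) (smul_nonneg (by norm_num) hT')
  have hUVx : ∀ x, U (V x) = V x := fun x => DFunLike.congr_fun hUV x
  have hVUx : ∀ x, adjoint V (U x) = adjoint V x := fun x => DFunLike.congr_fun hVU x
  have hSV : S ∘L V = V ∘L (adjoint V ∘L T ∘L V) := by
    ext x
    have : U (T (V x)) = V (adjoint V (T (V x))) + V (adjoint V (T (V x))) - T (V x) := by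
      simp [hU]
    simp only [hSdef, coe_comp, Function.comp_apply, add_apply, smul_apply, mul_def, hUVx, this]
    module
  have h1 : cfc f S ∘L V = V ∘L cfc f (adjoint V ∘L T ∘L V) :=
    cfc_comp_eq_comp_cfc (.of_nonneg hS) (.of_nonneg hB) hSV
      (hfc.mono (Set.union_subset (spec hS) (spec hB)))
  have h2 : cfc f (U * T * U) ∘L U = U ∘L cfc f T :=
    cfc_comp_eq_comp_cfc (.of_nonneg hT') (.of_nonneg hT)
      (by rw [← mul_def, mul_assoc, hUU, mul_one, mul_def])
      (hfc.mono (Set.union_subset (spec hT') (spec hT)))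
  have h3 := ((le_def _ _).1 hconv).adjoint_conj V
  rw [le_def]
  convert h3 using 1
  ext x
  have e1 : cfc f S (V x) = V (cfc f (adjoint V ∘L T ∘L V) x) := DFunLike.congr_fun h1 x
  have e2 : cfc f (U * T * U) (V x) = U (cfc f T (V x)) := by
    have := DFunLike.congr_fun h2 (V x)
    simpa [hUVx] using this
  simp only [coe_comp, Function.comp_apply, sub_apply, add_apply, smul_apply, e1, e2, map_sub,
    map_add, map_smul_of_tower, hVUx, hVx]
  module

open ContinuousLinearMap in
/-- Jensen's operator inequality for a finite positive resolution of the identity. -/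
lemma OperatorConvexOn.cfc_sum_smul_le {ι K : Type} [Fintype ι]
    [NormedAddCommGroup K] [InnerProductSpace ℂ K] [CompleteSpace K]
    {f : ℝ → ℝ} (hf : OperatorConvexOn f) (hfc : ContinuousOn f (Set.Ici 0))
    {P : ι → K →L[ℂ] K} (hP : ∀ i, 0 ≤ P i) (hP1 : ∑ i, P i = 1) {t : ι → ℝ} (ht : ∀ i, 0 ≤ t i) :
    cfc f (∑ i, t i • P i) ≤ ∑ i, f (t i) • P i := by
  let C : ι → K →L[ℂ] K := fun i => CFC.sqrt (P i)
  have hC : ∀ i x y, ⟪C i x, C i y⟫_ℂ = ⟪x, P i y⟫_ℂ := fun i x y => by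
    rw [← adjoint_inner_right, (IsSelfAdjoint.of_nonneg (CFC.sqrt_nonneg (P i))).adjoint_eq,
      ← comp_apply, ← mul_def, CFC.sqrt_mul_sqrt_self (P i) (hP i)]
  let e := PiLp.continuousLinearEquiv 2 ℂ (fun _ : ι => K)
  let V : K →L[ℂ] PiLp 2 (fun _ : ι => K) := e.symm.toContinuousLinearMap ∘L .pi C
  let T : PiLp 2 (fun _ : ι => K) →L[ℂ] PiLp 2 (fun _ : ι => K) :=
    e.symm.toContinuousLinearMap ∘L .pi fun i => t i • PiLp.proj 2 (fun _ : ι => K) i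
  have hVi : ∀ x i, V x i = C i x := fun x i => rfl
  have hTi : ∀ x i, T x i = t i • x i := fun x i => rfl
  have hV : adjoint V ∘L V = 1 := by
    ext x
    refine ext_inner_left ℂ fun y => ?_
    rw [coe_comp, Function.comp_apply, adjoint_inner_right, PiLp.inner_apply]
    simp only [hVi, hC, ← inner_sum, ← sum_apply, hP1]
  have hT : 0 ≤ T := by
    rw [nonneg_iff_isPositive, isPositive_def']
    refine ⟨?_, fun x => ?_⟩
    · rw [isSelfAdjoint_iff_isSymmetric]
      intro x y
      simp [PiLp.inner_apply, hTi, inner_smul_left_eq_star_smul, inner_smul_right_eq_smul]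
    · rw [reApplyInnerSelf_apply, PiLp.inner_apply, map_sum]
      refine Finset.sum_nonneg fun i _ => ?_
      rw [hTi, inner_smul_left_eq_star_smul, conj_trivial, RCLike.smul_re]
      exact mul_nonneg (ht i) inner_self_nonneg
  have hcomp : ∀ (g : ℝ → ℝ) (R : PiLp 2 (fun _ : ι => K) →L[ℂ] PiLp 2 (fun _ : ι => K)),
      (∀ x i, R x i = g (t i) • x i) → adjoint V ∘L R ∘L V = ∑ i, g (t i) • P i := by
    intro g R hR
    ext x
    refine ext_inner_left ℂ fun y => ?_
    rw [coe_comp, Function.comp_apply, adjoint_inner_right, PiLp.inner_apply]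
    simp [hVi, hR, inner_smul_right_eq_smul, hC, inner_sum, sum_apply]
  have hfT : ∀ x i, cfc f T x i = f (t i) • x i := by
    intro x i
    have hti : (0 : K →L[ℂ] K) ≤ algebraMap ℝ (K →L[ℂ] K) (t i) := by
      rw [Algebra.algebraMap_eq_smul_one]
      exact smul_nonneg (ht i) zero_le_one
    have := cfc_comp_eq_comp_cfc (V := PiLp.proj 2 (fun _ : ι => K) i) (.of_nonneg hti)
      (.of_nonneg hT) (f := f) (by ext x; simp [Algebra.algebraMap_eq_smul_one, hTi])
      (hfc.mono (Set.union_subset (fun x hx => spectrum_nonneg_of_nonneg hti hx)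
        (fun x hx => spectrum_nonneg_of_nonneg hT hx)))
    rw [cfc_algebraMap] at this
    have h := DFunLike.congr_fun this x
    simpa [Algebra.algebraMap_eq_smul_one] using h.symm
  rw [← hcomp f _ hfT, ← show _ = ∑ i, t i • P i from hcomp id T hTi]
  exact hf.cfc_adjoint_comp_le hfc hV hT

/-- Bernstein polynomials on `[0, R]` approximate continuous functions from above up to `ε`. -/
lemma exists_bernstein_approx {f : ℝ → ℝ} (hfc : ContinuousOn f (Set.Ici 0)) {R : ℝ} (hR : 0 < R)
    {ε : ℝ} (hε : 0 < ε) :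
    ∃ n ≠ 0, ∀ s ∈ Set.Icc 0 R, ∑ k : Fin (n + 1),
      f (R * (k / n)) * (bernsteinPolynomial ℝ n k).eval (s / R) ≤ f s + ε := by
  let g : C(unitInterval, ℝ) := ⟨fun x => f (R * x), hfc.comp_continuous (by fun_prop)
    fun x => mul_nonneg hR.le x.2.1⟩
  obtain ⟨n, hn, hn0⟩ := ((Metric.tendsto_nhds.1 (bernsteinApproximation_uniform g) ε hε).and
    (Filter.eventually_ne_atTop 0)).exists
  refine ⟨n, hn0, fun s hs => ?_⟩
  have hx : s / R ∈ unitInterval := ⟨div_nonneg hs.1 hR.le, (div_le_one hR).2 hs.2⟩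
  have h := (ContinuousMap.dist_apply_le_dist (⟨s / R, hx⟩ : unitInterval)).trans_lt hn
  rw [Real.dist_eq, bernsteinApproximation.apply] at h
  have h' := (abs_lt.1 h).2
  have hgs : g ⟨s / R, hx⟩ = f s := by simp [g, mul_div_cancel₀ _ hR.ne']
  rw [hgs] at h'
  have hsum : ∑ k : Fin (n + 1), f (R * (k / n)) * (bernsteinPolynomial ℝ n k).eval (s / R) =
      ∑ k : Fin (n + 1), bernstein n k ⟨s / R, hx⟩ • g (bernstein.z k) :=
    Finset.sum_congr rfl fun k _ => mul_comm _ _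
  rw [hsum]
  linarith

/-- The Choi-Davis-Jensen inequality for unital positive linear maps. -/
lemma OperatorConvexOn.cfc_map_le {K L : Type}
    [NormedAddCommGroup K] [InnerProductSpace ℂ K] [CompleteSpace K]
    [NormedAddCommGroup L] [InnerProductSpace ℂ L] [CompleteSpace L]
    {f : ℝ → ℝ} (hf : OperatorConvexOn f) (hfc : ContinuousOn f (Set.Ici 0))
    {Φ : (K →L[ℂ] K) →ₗ[ℂ] (L →L[ℂ] L)} (hΦ : ∀ A, 0 ≤ A → 0 ≤ Φ A) (hΦ1 : Φ 1 = 1)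
    {A : K →L[ℂ] K} (hA : 0 ≤ A) :
    cfc f (Φ A) ≤ Φ (cfc f A) := by
  have hAs : IsSelfAdjoint A := .of_nonneg hA
  have hmono : ∀ X Y, X ≤ Y → Φ X ≤ Φ Y := fun X Y h => by
    rw [← sub_nonneg, ← map_sub]
    exact hΦ _ (sub_nonneg.2 h)
  have hsmul : ∀ (r : ℝ) X, Φ (r • X) = r • Φ X := fun r X => Φ.map_smul_of_tower r X
  obtain ⟨R, hR, hspec⟩ : ∃ R > 0, spectrum ℝ A ⊆ Set.Icc 0 R := by
    obtain ⟨R, hR⟩ := (ContinuousFunctionalCalculus.isCompact_spectrum (R := ℝ) A).bddAbove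
    exact ⟨max R 1, by positivity, fun x hx =>
      ⟨spectrum_nonneg_of_nonneg hA hx, (hR hx).trans (le_max_left _ _)⟩⟩
  have hfA : ContinuousOn f (spectrum ℝ A) := hfc.mono fun x hx => (hspec hx).1
  have approx : ∀ ε : ℝ, 0 < ε → cfc f (Φ A) ≤ Φ (cfc f A) + ε • 1 := by
    intro ε hε
    obtain ⟨n, hn, hle⟩ := exists_bernstein_approx hfc hR hε
    let b : Fin (n + 1) → ℝ → ℝ := fun k s => (bernsteinPolynomial ℝ n k).eval (s / R)
    have hb : ∀ k, Continuous (b k) := fun k => by fun_prop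
    have hb0 : ∀ k, ∀ s ∈ Set.Icc 0 R, 0 ≤ b k s := fun k s hs =>
      bernstein_nonneg (n := n) (ν := k)
        (x := ⟨s / R, div_nonneg hs.1 hR.le, (div_le_one hR).2 hs.2⟩)
    have hb1 : ∀ s, ∑ k, b k s = 1 := fun s => by
      have := congrArg (Polynomial.eval (s / R)) (bernsteinPolynomial.sum ℝ n)
      simpa [Polynomial.eval_finsetSum, Finset.sum_range] using this
    have hbid : ∀ s, ∑ k : Fin (n + 1), (R * (k / n)) * b k s = s := fun s => by
      have := congrArg (Polynomial.eval (s / R)) (bernsteinPolynomial.sum_smul ℝ n)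
      simp only [Polynomial.eval_finsetSum, Finset.sum_range, nsmul_eq_mul, Polynomial.eval_mul,
        Polynomial.eval_natCast, Polynomial.eval_X] at this
      have hn' : (n : ℝ) ≠ 0 := Nat.cast_ne_zero.2 hn
      calc _ = R / n * ∑ k : Fin (n + 1), (k : ℝ) * b k s := by
            rw [Finset.mul_sum]
            exact Finset.sum_congr rfl fun k _ => by ring
        _ = s := by rw [this]; field_simp
    have hsum : ∀ c : Fin (n + 1) → ℝ,
        ∑ k, c k • Φ (cfc (b k) A) = Φ (cfc (fun s => ∑ k, c k * b k s) A) := fun c => by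
      have : (fun s => ∑ k, c k * b k s) = ∑ k, fun s => c k * b k s := by ext s; simp
      rw [this, cfc_sum_univ _ A fun k => (by fun_prop), map_sum]
      refine Finset.sum_congr rfl fun k _ => ?_
      rw [cfc_const_mul _ _ A (hb k).continuousOn, hsmul]
    have hP1 : ∑ k, Φ (cfc (b k) A) = 1 := by
      have := hsum 1
      simp only [Pi.one_apply, one_smul, one_mul, hb1] at this
      rw [this, cfc_const_one ℝ A, hΦ1]
    have hJ := hf.cfc_sum_smul_le hfc (P := fun k => Φ (cfc (b k) A))
      (fun k => hΦ _ (cfc_nonneg fun s hs => hb0 k s (hspec hs))) hP1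
      (t := fun k => R * (k / n)) (fun k => by positivity)
    rw [hsum, hsum] at hJ
    simp only [hbid] at hJ
    rw [cfc_id' ℝ A] at hJ
    refine hJ.trans ?_
    have : Φ (cfc f A) + ε • 1 = Φ (cfc (fun s => f s + ε) A) := by
      rw [cfc_add_const ε f A hfA, map_add, Algebra.algebraMap_eq_smul_one, hsmul, hΦ1]
    rw [this]
    exact hmono _ _ (cfc_mono (fun s hs => hle s (hspec hs))
      (by fun_prop) (hfA.add continuousOn_const))
  have hlim : Filter.Tendsto (fun ε : ℝ => Φ (cfc f A) + ε • (1 : L →L[ℂ] L))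
      (nhdsWithin 0 (Set.Ioi 0)) (nhds (Φ (cfc f A))) := by
    have : Continuous fun ε : ℝ => Φ (cfc f A) + ε • (1 : L →L[ℂ] L) := by fun_prop
    simpa using (this.tendsto 0).mono_left nhdsWithin_le_nhds
  exact ge_of_tendsto hlim (Filter.eventually_of_mem self_mem_nhdsWithin approx)

/-- For operator convex `f₁, f₂` on `[0, ∞)`, one has `f₁ ≤ f₂` pointwise if and only if
`f₁(Φ(A)) ≤ Φ(f₂(A))` for every Hilbert space, every unital positive linear map `Φ` and
every positive operator `A`. -/
theorem stmt_9 (f₁ f₂ : ℝ → ℝ)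
    (hf₁_cont : ContinuousOn f₁ (Set.Ici (0 : ℝ))) (hf₂_cont : ContinuousOn f₂ (Set.Ici (0 : ℝ)))
    (hf₁ : OperatorConvexOn f₁) (hf₂ : OperatorConvexOn f₂) :
    (∀ t : ℝ, 0 ≤ t → f₁ t ≤ f₂ t) ↔
      ∀ (K : Type) [NormedAddCommGroup K] [InnerProductSpace ℂ K] [CompleteSpace K],
        ∀ Φ : (K →L[ℂ] K) →ₗ[ℂ] (K →L[ℂ] K),
          (∀ A : K →L[ℂ] K, 0 ≤ A → 0 ≤ Φ A) → Φ 1 = 1 →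
          ∀ A : K →L[ℂ] K, 0 ≤ A → cfc f₁ (Φ A) ≤ Φ (cfc f₂ A) := by
  constructor
  · intro h K _ _ _ Φ hΦ hΦ1 A hA
    have hspec : spectrum ℝ A ⊆ Set.Ici 0 := fun x hx => spectrum_nonneg_of_nonneg hA hx
    have hle : cfc f₁ A ≤ cfc f₂ A := cfc_mono (fun x hx => h x (hspec hx))
      (hf₁_cont.mono hspec) (hf₂_cont.mono hspec)
    refine (hf₁.cfc_map_le hf₁_cont hΦ hΦ1 hA).trans ?_
    rw [← sub_nonneg, ← map_sub]
    exact hΦ _ (sub_nonneg.2 hle)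
  · intro h t ht
    have ht' : (0 : ℂ →L[ℂ] ℂ) ≤ algebraMap ℝ (ℂ →L[ℂ] ℂ) t := by
      rw [Algebra.algebraMap_eq_smul_one]
      exact smul_nonneg ht zero_le_one
    have key := h ℂ LinearMap.id (fun A hA => hA) rfl _ ht'
    rw [LinearMap.id_apply, cfc_algebraMap, cfc_algebraMap, ContinuousLinearMap.le_def] at key
    simpa [ContinuousLinearMap.reApplyInnerSelf, Algebra.algebraMap_eq_smul_one]
      using key.re_inner_nonneg_left 1
end
end
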